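/- arXiv:1906.05065 — 2 statements merged into one kernel-verified Lean document; each statement's English description precedes it below -/
import Mathlib

section
/- For all S, σ, τ > 0 and r, δ ∈ ℝ, the Black–Scholes call price is twice differentiable in the strike with ∂²C/∂K² (S, σ, r, δ, K, τ) = e^{-rτ} φ(d₋)/(K σ √τ) > 0 for all K > 0; in particular K ↦ C(S, σ, r, δ, K, τ) is strictly convex on (0, ∞). -/
open Real Filter Set

/-- Standard normal CDF. -/
noncomputable def stdNormalCDF (x : ℝ) : ℝ :=
  (Real.sqrt (2 * Real.pi))⁻¹ * ∫ t in Set.Iic x, Real.exp (-t ^ 2 / 2)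

/-- Standard normal density. -/
noncomputable def stdNormalPDF (x : ℝ) : ℝ :=
  (Real.sqrt (2 * Real.pi))⁻¹ * Real.exp (-x ^ 2 / 2)

/-- d₊ in the Black–Scholes formula. -/
noncomputable def dPlus (S σ r δ K τ : ℝ) : ℝ :=
  (Real.log (S / K) + (r - δ) * τ) / (σ * Real.sqrt τ) + σ * Real.sqrt τ / 2

/-- d₋ in the Black–Scholes formula. -/
noncomputable def dMinus (S σ r δ K τ : ℝ) : ℝ :=
  (Real.log (S / K) + (r - δ) * τ) / (σ * Real.sqrt τ) - σ * Real.sqrt τ / 2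

/-- Black–Scholes call price. -/
noncomputable def bsCall (S σ r δ K τ : ℝ) : ℝ :=
  S * Real.exp (-δ * τ) * stdNormalCDF (dPlus S σ r δ K τ)
    - K * Real.exp (-r * τ) * stdNormalCDF (dMinus S σ r δ K τ)

theorem bs_cdf_deriv (x : ℝ) : HasDerivAt stdNormalCDF (stdNormalPDF x) x := by
  have hint : MeasureTheory.Integrable (fun t : ℝ => Real.exp (-t ^ 2 / 2)) := by
    have h := integrable_exp_neg_mul_sq (b := 1 / 2) (by norm_num)
    refine h.congr (Filter.Eventually.of_forall fun t => ?_)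
    simp only
    congr 1
    ring
  have hc : Continuous (fun t : ℝ => Real.exp (-t ^ 2 / 2)) := by fun_prop
  have h1 : HasDerivAt (fun y : ℝ => ∫ t in (0 : ℝ)..y, Real.exp (-t ^ 2 / 2))
      (Real.exp (-x ^ 2 / 2)) x :=
    intervalIntegral.integral_hasDerivAt_right (hc.intervalIntegrable _ _)
      (hc.stronglyMeasurableAtFilter _ _) hc.continuousAt
  have h2 := ((h1.const_add (∫ t in Set.Iic (0 : ℝ), Real.exp (-t ^ 2 / 2))).const_mul
    (Real.sqrt (2 * Real.pi))⁻¹)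
  have e : stdNormalCDF = fun y => (Real.sqrt (2 * Real.pi))⁻¹ *
      ((∫ t in Set.Iic (0 : ℝ), Real.exp (-t ^ 2 / 2)) +
        ∫ t in (0 : ℝ)..y, Real.exp (-t ^ 2 / 2)) := by
    funext y
    rw [← intervalIntegral.integral_Iic_sub_Iic hint.integrableOn hint.integrableOn]
    simp [stdNormalCDF]
  rw [e]
  exact h2

theorem bs_dMinus_deriv (S σ τ r δ K : ℝ) (hS : 0 < S) (hσ : 0 < σ) (hτ : 0 < τ) (hK : 0 < K) :
    HasDerivAt (fun K' => dMinus S σ r δ K' τ) (-(1 / (K * σ * Real.sqrt τ))) K := by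
  have hs : 0 < Real.sqrt τ := Real.sqrt_pos.mpr hτ
  have h0 : HasDerivAt (fun K' => Real.log (S / K')) (-(1 / K)) K := by
    have h := (Real.hasDerivAt_log hK.ne').const_sub (Real.log S)
    rw [one_div]
    refine h.congr_of_eventuallyEq ?_
    filter_upwards [lt_mem_nhds hK] with y hy
    exact Real.log_div hS.ne' hy.ne'
  have h := (((h0.add_const ((r - δ) * τ)).div_const (σ * Real.sqrt τ)).sub_const
    (σ * Real.sqrt τ / 2))
  refine HasDerivAt.congr_deriv (f := fun K' => dMinus S σ r δ K' τ) h ?_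
  field_simp

theorem bs_key (S σ τ r δ K : ℝ) (hS : 0 < S) (hσ : 0 < σ) (hτ : 0 < τ) (hK : 0 < K) :
    S * Real.exp (-δ * τ) * stdNormalPDF (dPlus S σ r δ K τ) =
      K * Real.exp (-r * τ) * stdNormalPDF (dMinus S σ r δ K τ) := by
  have hs : 0 < Real.sqrt τ := Real.sqrt_pos.mpr hτ
  have h : Real.exp (Real.log S) * Real.exp (-δ * τ) * Real.exp (-(dPlus S σ r δ K τ) ^ 2 / 2) =
      Real.exp (Real.log K) * Real.exp (-r * τ) * Real.exp (-(dMinus S σ r δ K τ) ^ 2 / 2) := by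
    rw [← Real.exp_add, ← Real.exp_add, ← Real.exp_add, ← Real.exp_add]
    congr 1
    unfold dPlus dMinus
    rw [Real.log_div hS.ne' hK.ne']
    have hv : σ * Real.sqrt τ ≠ 0 := by positivity
    generalize σ * Real.sqrt τ = v at hv
    field_simp
    ring
  rw [Real.exp_log hS, Real.exp_log hK] at h
  unfold stdNormalPDF
  linear_combination (Real.sqrt (2 * Real.pi))⁻¹ * h

theorem bs_deriv1 (S σ τ r δ K : ℝ) (hS : 0 < S) (hσ : 0 < σ) (hτ : 0 < τ) (hK : 0 < K) :
    HasDerivAt (fun K' => bsCall S σ r δ K' τ)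
      (-(Real.exp (-r * τ) * stdNormalCDF (dMinus S σ r δ K τ))) K := by
  have hm := bs_dMinus_deriv S σ τ r δ K hS hσ hτ hK
  have hp : HasDerivAt (fun K' => dPlus S σ r δ K' τ) (-(1 / (K * σ * Real.sqrt τ))) K := by
    have h := hm.add_const (σ * Real.sqrt τ)
    have e : (fun K' => dPlus S σ r δ K' τ) =
        fun x => dMinus S σ r δ x τ + σ * Real.sqrt τ := by
      funext y
      simp only [dPlus, dMinus]
      ring
    rw [e]
    exact h
  have h1 := ((bs_cdf_deriv (dPlus S σ r δ K τ)).comp K hp).const_mul (S * Real.exp (-δ * τ))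
  have h2 := ((hasDerivAt_id K).mul_const (Real.exp (-r * τ))).mul
    ((bs_cdf_deriv (dMinus S σ r δ K τ)).comp K hm)
  have h := h1.sub h2
  have hk := bs_key S σ τ r δ K hS hσ hτ hK
  refine HasDerivAt.congr_deriv (f := fun K' => bsCall S σ r δ K' τ) h ?_
  simp only [id, Function.comp]
  linear_combination (-(1 / (K * σ * Real.sqrt τ))) * hk

/-- The Black–Scholes call price is twice differentiable in the strike with positive
second derivative `e^{−rτ} φ(d₋)/(K σ √τ)`, hence strictly convex in `K` on `(0, ∞)`. -/
theorem stmt_5 (S σ τ r δ : ℝ) (hS : 0 < S) (hσ : 0 < σ) (hτ : 0 < τ) :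
    (∀ K : ℝ, 0 < K →
      HasDerivAt (deriv fun K' => bsCall S σ r δ K' τ)
        (Real.exp (-r * τ) * stdNormalPDF (dMinus S σ r δ K τ) / (K * σ * Real.sqrt τ)) K ∧
      0 < Real.exp (-r * τ) * stdNormalPDF (dMinus S σ r δ K τ) / (K * σ * Real.sqrt τ)) ∧
    StrictConvexOn ℝ (Set.Ioi 0) (fun K => bsCall S σ r δ K τ) := by
  have hs : 0 < Real.sqrt τ := Real.sqrt_pos.mpr hτ
  have main : ∀ K : ℝ, 0 < K →
      HasDerivAt (deriv fun K' => bsCall S σ r δ K' τ)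
        (Real.exp (-r * τ) * stdNormalPDF (dMinus S σ r δ K τ) / (K * σ * Real.sqrt τ)) K ∧
      0 < Real.exp (-r * τ) * stdNormalPDF (dMinus S σ r δ K τ) / (K * σ * Real.sqrt τ) := by
    intro K hK
    constructor
    · have h := (((bs_cdf_deriv (dMinus S σ r δ K τ)).comp K
        (bs_dMinus_deriv S σ τ r δ K hS hσ hτ hK)).const_mul (Real.exp (-r * τ))).neg
      refine (h.congr_of_eventuallyEq ?_).congr_deriv ?_
      · filter_upwards [lt_mem_nhds hK] with y hy
        exact (bs_deriv1 S σ τ r δ y hS hσ hτ hy).deriv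
      · ring
    · unfold stdNormalPDF
      positivity
  refine ⟨main, ?_⟩
  apply strictConvexOn_of_deriv2_pos (convex_Ioi 0)
  · intro K hK
    exact (bs_deriv1 S σ τ r δ K hS hσ hτ hK).continuousAt.continuousWithinAt
  · intro K hK
    rw [interior_Ioi] at hK
    have h := main K hK
    simp only [Function.iterate_succ, Function.iterate_zero, Function.comp, id]
    rw [h.1.deriv]
    exact h.2
end

section
/- For all S, K, τ > 0 and r, δ ∈ ℝ, the Black–Scholes call price attains its extreme bounds in the volatility limits: lim_{σ → 0⁺} C(S, σ, r, δ, K, τ) = max(S e^{-δτ} − K e^{-rτ}, 0) and lim_{σ → ∞} C(S, σ, r, δ, K, τ) = S e^{-δτ}. -/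
open Real Filter Set

lemma gInt : MeasureTheory.Integrable (fun t : ℝ => Real.exp (-t ^ 2 / 2)) := by
  have h := integrable_exp_neg_mul_sq (b := 1 / 2) (by norm_num)
  refine h.congr (Eventually.of_forall fun t => ?_)
  ring_nf

lemma gTot : ∫ t : ℝ, Real.exp (-t ^ 2 / 2) = Real.sqrt (2 * Real.pi) := by
  have h := integral_gaussian (1 / 2)
  rw [show Real.pi / (1 / 2) = 2 * Real.pi by ring] at h
  rw [← h]
  congr 1; ext t; congr 1; ring

lemma sq_ne : Real.sqrt (2 * Real.pi) ≠ 0 := by positivity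

lemma cdf_top : Tendsto stdNormalCDF atTop (nhds 1) := by
  have h := (MeasureTheory.aecover_Iic (μ := MeasureTheory.volume)
    (tendsto_id (α := ℝ) (x := atTop))).integral_tendsto_of_countably_generated gInt
  have h2 := h.const_mul (Real.sqrt (2 * Real.pi))⁻¹
  rw [gTot, inv_mul_cancel₀ sq_ne] at h2
  exact h2

lemma cdf_bot : Tendsto stdNormalCDF atBot (nhds 0) := by
  have h := (MeasureTheory.aecover_Ioi (μ := MeasureTheory.volume)
    (tendsto_id (α := ℝ) (x := atBot))).integral_tendsto_of_countably_generated gInt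
  have h2 := (h.const_sub (∫ t : ℝ, Real.exp (-t ^ 2 / 2))).const_mul (Real.sqrt (2 * Real.pi))⁻¹
  rw [sub_self, mul_zero] at h2
  refine h2.congr fun x => ?_
  unfold stdNormalCDF
  rw [← intervalIntegral.integral_Iic_add_Ioi gInt.integrableOn gInt.integrableOn (b := x)]
  simp

lemma cdf_cont : Continuous stdNormalCDF := by
  have h : stdNormalCDF = fun x => (Real.sqrt (2 * Real.pi))⁻¹ *
      ((∫ t in Set.Iic (0 : ℝ), Real.exp (-t ^ 2 / 2)) + ∫ t in (0 : ℝ)..x, Real.exp (-t ^ 2 / 2)) := by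
    ext x
    unfold stdNormalCDF
    rw [← intervalIntegral.integral_Iic_sub_Iic gInt.integrableOn gInt.integrableOn]
    ring
  rw [h]
  exact continuous_const.mul (continuous_const.add
    (intervalIntegral.continuous_primitive (fun a b => gInt.intervalIntegrable) 0))

/-- Volatility limits of the Black–Scholes call price: the lower no-arbitrage bound as
`σ → 0⁺` and the upper bound as `σ → ∞`. -/
theorem stmt_7 (S K τ r δ : ℝ) (hS : 0 < S) (hK : 0 < K) (hτ : 0 < τ) :
    Filter.Tendsto (fun σ => bsCall S σ r δ K τ) (nhdsWithin 0 (Set.Ioi 0))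
      (nhds (max (S * Real.exp (-δ * τ) - K * Real.exp (-r * τ)) 0)) ∧
    Filter.Tendsto (fun σ => bsCall S σ r δ K τ) Filter.atTop
      (nhds (S * Real.exp (-δ * τ))) := by
  set m := Real.log (S / K) + (r - δ) * τ with hm
  have hs : 0 < Real.sqrt τ := Real.sqrt_pos.2 hτ
  have hrel : S * Real.exp (-δ * τ) = K * Real.exp (-r * τ) * Real.exp m := by
    rw [hm, Real.exp_add, Real.exp_log (by positivity)]
    have : Real.exp (-δ * τ) = Real.exp (-r * τ) * Real.exp ((r - δ) * τ) := by
      rw [← Real.exp_add]; congr 1; ring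
    rw [this]; field_simp
  have hB : 0 < K * Real.exp (-r * τ) := by positivity
  unfold bsCall dPlus dMinus
  rw [← hm]
  constructor
  · have hu : Tendsto (fun σ : ℝ => σ * Real.sqrt τ) (nhdsWithin 0 (Set.Ioi 0))
        (nhdsWithin 0 (Set.Ioi 0)) := by
      refine tendsto_nhdsWithin_iff.2 ⟨?_, ?_⟩
      · have : Tendsto (fun σ : ℝ => σ * Real.sqrt τ) (nhds 0) (nhds (0 * Real.sqrt τ)) :=
          tendsto_id.mul_const _
        rw [zero_mul] at this
        exact this.mono_left nhdsWithin_le_nhds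
      · filter_upwards [self_mem_nhdsWithin] with σ hσ
        exact mul_pos hσ hs
    have hi := tendsto_inv_nhdsGT_zero.comp hu
    have h2 : Tendsto (fun σ : ℝ => σ * Real.sqrt τ / 2) (nhdsWithin 0 (Set.Ioi 0)) (nhds 0) := by
      simpa using (tendsto_nhdsWithin_iff.1 hu).1.div_const 2
    have h2n : Tendsto (fun σ : ℝ => -(σ * Real.sqrt τ / 2)) (nhdsWithin 0 (Set.Ioi 0)) (nhds 0) := by
      simpa using h2.neg
    simp only [div_eq_mul_inv m]
    rcases lt_trichotomy m 0 with h | h | h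
    · have hd := hi.const_mul_atTop_of_neg h
      have hle : S * Real.exp (-δ * τ) - K * Real.exp (-r * τ) ≤ 0 := by
        rw [hrel]; nlinarith [Real.exp_lt_one_iff.2 h]
      rw [max_eq_right hle]
      simpa [← sub_eq_add_neg] using ((cdf_bot.comp (hd.atBot_add h2)).const_mul (S * Real.exp (-δ * τ))).sub
        ((cdf_bot.comp (hd.atBot_add h2n)).const_mul (K * Real.exp (-r * τ)))
    · rw [hrel, h]
      simp only [zero_mul, zero_add, Real.exp_zero, mul_one, sub_self, max_self]
      have c := cdf_cont.tendsto 0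
      simpa using ((c.comp h2).const_mul (K * Real.exp (-r * τ))).sub
        ((c.comp h2n).const_mul (K * Real.exp (-r * τ)))
    · have hd := hi.const_mul_atTop h
      have hle : 0 ≤ S * Real.exp (-δ * τ) - K * Real.exp (-r * τ) := by
        rw [hrel]; nlinarith [Real.one_lt_exp_iff.2 h]
      rw [max_eq_left hle]
      simpa [← sub_eq_add_neg] using ((cdf_top.comp (hd.atTop_add h2)).const_mul (S * Real.exp (-δ * τ))).sub
        ((cdf_top.comp (hd.atTop_add h2n)).const_mul (K * Real.exp (-r * τ)))
  · have hu : Tendsto (fun σ : ℝ => σ * Real.sqrt τ) atTop atTop := tendsto_id.atTop_mul_const hs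
    have h0 : Tendsto (fun σ : ℝ => m / (σ * Real.sqrt τ)) atTop (nhds 0) := hu.const_div_atTop m
    have h2 : Tendsto (fun σ : ℝ => σ * Real.sqrt τ / 2) atTop atTop :=
      hu.atTop_div_const (by norm_num)
    have hn : Tendsto (fun σ : ℝ => -(σ * Real.sqrt τ / 2)) atTop atBot :=
      tendsto_neg_atTop_atBot.comp h2
    simp only [sub_eq_add_neg (m / _)]
    simpa [← sub_eq_add_neg] using ((cdf_top.comp (h0.add_atTop h2)).const_mul (S * Real.exp (-δ * τ))).sub
      ((cdf_bot.comp (h0.add_atBot hn)).const_mul (K * Real.exp (-r * τ)))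
end
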